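/- Let 2 ≤ k ≤ n be integers, let α_0, α_1, …, α_{k−2} be nonnegative real numbers, and let λ ∈ Γ_k. Define G^{ii}(λ) = [ σ_{k−1}(λ|i)·σ_{k−1}(λ) − σ_k(λ)·σ_{k−2}(λ|i) − Σ_{l=0}^{k−2} α_l·( σ_{l−1}(λ|i)·σ_{k−1}(λ) − σ_l(λ)·σ_{k−2}(λ|i) ) ] / σ_{k−1}(λ)². Then Σ_{i=1}^n G^{ii}(λ) ≥ (n−k+1)/k. -/

import Mathlib

/-- The `m`-th elementary symmetric function of `λ = (λ_1, …, λ_n) ∈ ℝⁿ`. -/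
def esymm (n m : ℕ) (lam : Fin n → ℝ) : ℝ :=
  ∑ s ∈ (Finset.univ : Finset (Fin n)).powersetCard m, ∏ i ∈ s, lam i

/-- The `m`-th elementary symmetric function for an integer index `m`, with
`σ_m = 0` for `m < 0`. -/
def esymmZ (n : ℕ) (m : ℤ) (lam : Fin n → ℝ) : ℝ :=
  if 0 ≤ m then esymm n m.toNat lam else 0

/-- The Gårding cone `Γ_k = {λ ∈ ℝⁿ : σ_j(λ) > 0 for all 1 ≤ j ≤ k}`. -/
def GardingCone (n m : ℕ) : Set (Fin n → ℝ) :=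
  {lam | ∀ j : ℕ, 1 ≤ j → j ≤ m → 0 < esymm n j lam}

/-- `G^{ii}(λ)`, the partial derivative with respect to `λ_i` of the operator
`G(λ) = σ_k(λ)/σ_{k-1}(λ) - Σ_{l=0}^{k-2} α_l·σ_l(λ)/σ_{k-1}(λ)`:
`G^{ii}(λ) = [σ_{k-1}(λ|i)·σ_{k-1}(λ) - σ_k(λ)·σ_{k-2}(λ|i)
  - Σ_{l=0}^{k-2} α_l·(σ_{l-1}(λ|i)·σ_{k-1}(λ) - σ_l(λ)·σ_{k-2}(λ|i))] / σ_{k-1}(λ)²`. -/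
noncomputable def Gii (n k : ℕ) (α : ℕ → ℝ) (lam : Fin n → ℝ) (i : Fin n) : ℝ :=
  (esymm n (k - 1) (Function.update lam i 0) * esymm n (k - 1) lam -
      esymm n k lam * esymm n (k - 2) (Function.update lam i 0) -
      ∑ l ∈ Finset.range (k - 1),
        α l * (esymmZ n ((l : ℤ) - 1) (Function.update lam i 0) * esymm n (k - 1) lam -
          esymm n l lam * esymm n (k - 2) (Function.update lam i 0))) /
    (esymm n (k - 1) lam) ^ 2

open Polynomial in
/-- Laguerre's inequality at `0` for a product of linear factors, in terms of coefficients. -/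
theorem laguerre_coeff_prod (s : Multiset ℝ) :
    2 * (s.card : ℝ) * ((s.map fun r => X - C r).prod.coeff 0 *
      (s.map fun r => X - C r).prod.coeff 2) ≤
      ((s.card : ℝ) - 1) * (s.map fun r => X - C r).prod.coeff 1 ^ 2 := by
  induction s using Multiset.induction_on with
  | empty => simp [coeff_one]
  | cons r s ih =>
    simp only [Multiset.map_cons, Multiset.prod_cons, Multiset.card_cons]
    rcases Nat.eq_zero_or_pos s.card with h0 | hpos
    · simp [Multiset.card_eq_zero.mp h0, coeff_X]
    set Q := (s.map fun r => X - C r).prod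
    have hN : (0 : ℝ) < s.card := by exact_mod_cast hpos
    have e0 : ((X - C r) * Q).coeff 0 = -r * Q.coeff 0 := by simp [sub_mul]
    have e1 : ((X - C r) * Q).coeff 1 = Q.coeff 0 - r * Q.coeff 1 := by
      simp [sub_mul, coeff_X_mul]
    have e2 : ((X - C r) * Q).coeff 2 = Q.coeff 1 - r * Q.coeff 2 := by
      simp [sub_mul, coeff_X_mul]
    rw [e0, e1, e2]
    push_cast
    generalize (s.card : ℝ) = N at *
    generalize Q.coeff 0 = a at *
    generalize Q.coeff 1 = b at *
    generalize Q.coeff 2 = c at *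
    refine le_of_mul_le_mul_left ?_ hN
    have h1 := mul_le_mul_of_nonneg_left ih (mul_nonneg (sq_nonneg r) (by linarith : 0 ≤ N + 1))
    nlinarith [sq_nonneg (N * a + r * b)]

open Polynomial in
/-- Laguerre's inequality at `0` for a real polynomial with only real roots. -/
theorem Polynomial.Splits.laguerre_coeff {p : ℝ[X]} (hp : p.Splits) :
    2 * (p.natDegree : ℝ) * (p.coeff 0 * p.coeff 2) ≤
      ((p.natDegree : ℝ) - 1) * p.coeff 1 ^ 2 := by
  have h := mul_le_mul_of_nonneg_left (laguerre_coeff_prod p.roots) (sq_nonneg p.leadingCoeff)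
  have hc (i : ℕ) : p.coeff i =
      p.leadingCoeff * (p.roots.map fun r => X - C r).prod.coeff i := by
    conv_lhs => rw [hp.eq_prod_roots]
    rw [coeff_C_mul]
  rw [hc 0, hc 1, hc 2, hp.natDegree_eq_card_roots]
  linarith

open Polynomial in
/-- By Rolle, the derivative of a real polynomial with only real roots has only real roots. -/
theorem Polynomial.Splits.derivative_real {p : ℝ[X]} (hp : p.Splits) :
    (derivative p).Splits := by
  rw [splits_iff_card_roots]
  have h1 := card_roots_le_derivative p
  have h2 := card_roots' (derivative p)
  have h3 := natDegree_derivative p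
  have h4 := hp.natDegree_eq_card_roots
  omega

open Polynomial in
/-- Newton's inequality for the coefficients of a real polynomial with only real roots. -/
theorem Polynomial.Splits.newton_coeff {p : ℝ[X]} (hp : p.Splits) {m N : ℕ}
    (hN : p.natDegree = m + N) :
    (N : ℝ) * (m + 2) * (p.coeff m * p.coeff (m + 2)) ≤
      ((N : ℝ) - 1) * (m + 1) * p.coeff (m + 1) ^ 2 := by
  have key : (derivative^[m] p).Splits ∧ (derivative^[m] p).natDegree = N := by
    have : ∀ j, (derivative^[j] p).Splits ∧ (derivative^[j] p).natDegree = p.natDegree - j := by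
      intro j
      induction j with
      | zero => simpa using hp
      | succ j ih =>
        rw [Function.iterate_succ_apply', natDegree_derivative, ih.2]
        exact ⟨ih.1.derivative_real, by omega⟩
    have h := this m
    rwa [hN, Nat.add_sub_cancel_left] at h
  have h := key.1.laguerre_coeff
  rw [key.2] at h
  simp only [coeff_iterate_derivative, nsmul_eq_mul] at h
  have d0 : (((0 + m).descFactorial m : ℕ) : ℝ) = m.factorial := by
    simp [Nat.descFactorial_self]
  have d1 : (((1 + m).descFactorial m : ℕ) : ℝ) = (m + 1) * m.factorial := by
    have := Nat.factorial_mul_descFactorial (n := 1 + m) (k := m) (by omega)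
    rw [show 1 + m - m = 1 by omega, add_comm 1 m] at this
    rw [add_comm 1 m]
    have h2 : ((m + 1).descFactorial m) = (m + 1) * m.factorial := by
      simpa [Nat.factorial_succ] using this
    exact_mod_cast h2
  have d2 : 2 * (((2 + m).descFactorial m : ℕ) : ℝ) = (m + 2) * ((m + 1) * m.factorial) := by
    have := Nat.factorial_mul_descFactorial (n := 2 + m) (k := m) (by omega)
    rw [show 2 + m - m = 2 by omega, add_comm 2 m] at this
    rw [add_comm 2 m]
    have h2 : 2 * ((m + 2).descFactorial m) = (m + 2) * ((m + 1) * m.factorial) := by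
      simpa [Nat.factorial_succ] using this
    exact_mod_cast h2
  have e2 : (((2 + m).descFactorial m : ℕ) : ℝ) = (m + 2) * ((m + 1) * m.factorial) / 2 := by
    linarith
  rw [d0, d1, e2, zero_add, add_comm 1 m, add_comm 2 m] at h
  have hf : (0 : ℝ) < (m + 1) * (m.factorial : ℝ) ^ 2 := by positivity
  refine le_of_mul_le_mul_left ?_ hf
  linarith

/-- Newton's inequality for elementary symmetric functions of real numbers. -/
theorem esymm_newton (n j : ℕ) (hj : j + 2 ≤ n) (lam : Fin n → ℝ) :
    ((j : ℝ) + 2) * (n - j) * (esymm n (j + 2) lam * esymm n j lam) ≤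
      ((j : ℝ) + 1) * (n - j - 1) * esymm n (j + 1) lam ^ 2 := by
  obtain ⟨m, rfl⟩ : ∃ m, n = m + (j + 2) := ⟨n - (j + 2), by omega⟩
  set p : Polynomial ℝ := ∏ i : Fin (m + (j + 2)), (Polynomial.X + Polynomial.C (lam i)) with hp
  have hs : p.Splits := Polynomial.Splits.prod fun i _ => Polynomial.Splits.X_add_C _
  have hd : p.natDegree = m + (j + 2) := by
    rw [hp, Polynomial.natDegree_prod_of_monic _ _ fun i _ => Polynomial.monic_X_add_C _]
    simp
  have hc (i l : ℕ) (hil : i + l = m + (j + 2)) : p.coeff i = esymm (m + (j + 2)) l lam := by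
    rw [hp, Finset.prod_X_add_C_coeff _ _ (by simp; omega), Finset.card_univ, Fintype.card_fin,
      show m + (j + 2) - i = l by omega]
    rfl
  have h := hs.newton_coeff hd
  rw [hc m (j + 2) rfl, hc (m + 1) (j + 1) (by omega), hc (m + 2) j (by omega)] at h
  push_cast at h ⊢
  linarith

theorem sum_esymm_update_zero (n m : ℕ) (lam : Fin n → ℝ) :
    ∑ i, esymm n m (Function.update lam i 0) = ((n : ℝ) - m) * esymm n m lam := by
  unfold esymm
  rw [Finset.sum_comm, Finset.mul_sum]
  refine Finset.sum_congr rfl fun s hs => ?_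
  have hcard : s.card = m := (Finset.mem_powersetCard.mp hs).2
  have hprod (i : Fin n) : ∏ x ∈ s, Function.update lam i 0 x =
      if i ∈ sᶜ then ∏ x ∈ s, lam x else 0 := by
    by_cases hi : i ∈ s
    · simpa [hi] using Finset.prod_eq_zero hi (by simp)
    · simp [hi, Finset.prod_update_of_notMem]
  have hle : m ≤ n := by simpa [hcard] using s.card_le_univ
  simp only [hprod, Finset.sum_ite_mem, Finset.univ_inter, Finset.sum_const, nsmul_eq_mul,
    Finset.card_compl, Fintype.card_fin, hcard, Nat.cast_sub hle]

/-- The ratios `(n - j) σ_j / σ_{j+1}` increase with `j` on the Gårding cone. -/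
theorem esymm_mul_le_of_le (n l K : ℕ) (hlK : l ≤ K) (hK : K + 1 ≤ n) (lam : Fin n → ℝ)
    (hpos : ∀ j ≤ K + 1, 0 < esymm n j lam) :
    ((n : ℝ) - l) * (esymm n l lam * esymm n (K + 1) lam) ≤
      ((n : ℝ) - K) * (esymm n (l + 1) lam * esymm n K lam) := by
  induction K, hlK using Nat.le_induction with
  | base => linarith
  | succ K hlK ih =>
    have h1 := ih (by omega) fun j hj => hpos j (by omega)
    have h2 := esymm_newton n K hK lam
    have p0 := hpos K (by omega)
    have p1 := hpos (K + 1) (by omega)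
    have p2 := hpos (K + 2) le_rfl
    have p3 := hpos (l + 1) (by omega)
    have hn : (K : ℝ) + 2 ≤ n := by exact_mod_cast hK
    have h3 : ((n : ℝ) - K) * (esymm n (K + 2) lam * esymm n K lam) ≤
        (n - K - 1) * esymm n (K + 1) lam ^ 2 := by
      have hK1 : (0 : ℝ) < (K : ℝ) + 1 := by positivity
      refine le_of_mul_le_mul_left ?_ hK1
      have : 0 ≤ ((n : ℝ) - K) * (esymm n (K + 2) lam * esymm n K lam) :=
        mul_nonneg (by linarith) (by positivity)
      linarith
    refine le_of_mul_le_mul_right ?_ p1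
    push_cast
    have h4 := mul_le_mul_of_nonneg_right h1 p2.le
    have h5 := mul_le_mul_of_nonneg_left h3 p3.le
    rw [show K + 1 + 1 = K + 2 from rfl]
    linarith

/-- For `2 ≤ k ≤ n`, nonnegative `α_0, …, α_{k-2}` and `λ ∈ Γ_k`:
`Σ_{i=1}^n G^{ii}(λ) ≥ (n-k+1)/k`. -/
theorem sum_Gii_ge (n k : ℕ) (hk : 2 ≤ k) (hkn : k ≤ n) (α : ℕ → ℝ)
    (hα : ∀ l, l ≤ k - 2 → 0 ≤ α l) (lam : Fin n → ℝ) (hlam : lam ∈ GardingCone n k) :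
    ((n : ℝ) - (k : ℝ) + 1) / (k : ℝ) ≤ ∑ i : Fin n, Gii n k α lam i := by
  obtain ⟨K, rfl⟩ : ∃ K, k = K + 2 := ⟨k - 2, by omega⟩
  have hpos : ∀ j ≤ K + 2, 0 < esymm n j lam := by
    intro j hj
    rcases Nat.eq_zero_or_pos j with rfl | h
    · simp [esymm]
    · exact hlam j h hj
  have hn : (K : ℝ) + 2 ≤ n := by exact_mod_cast hkn
  have p0 := hpos K (by omega)
  have p1 := hpos (K + 1) (by omega)
  simp only [Gii, show K + 2 - 1 = K + 1 from rfl, show K + 2 - 2 = K from rfl] at hα ⊢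
  rw [← Finset.sum_div, Finset.sum_sub_distrib, Finset.sum_sub_distrib, ← Finset.sum_mul,
    ← Finset.mul_sum, Finset.sum_comm, sum_esymm_update_zero, sum_esymm_update_zero]
  have hterm : ∑ l ∈ Finset.range (K + 1), ∑ i : Fin n,
      α l * (esymmZ n ((l : ℤ) - 1) (Function.update lam i 0) * esymm n (K + 1) lam -
          esymm n l lam * esymm n K (Function.update lam i 0)) ≤ 0 := by
    refine Finset.sum_nonpos fun l hl => ?_
    have hlK : l ≤ K := by simpa [Nat.lt_succ_iff] using hl
    rw [← Finset.mul_sum, Finset.sum_sub_distrib, ← Finset.sum_mul, ← Finset.mul_sum,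
      sum_esymm_update_zero]
    refine mul_nonpos_of_nonneg_of_nonpos (hα l hlK) ?_
    cases l with
    | zero =>
      have : 0 ≤ esymm n 0 lam * (((n : ℝ) - K) * esymm n K lam) :=
        mul_nonneg (hpos 0 (by omega)).le (mul_nonneg (by linarith) p0.le)
      simpa [esymmZ] using this
    | succ l =>
      have h := esymm_mul_le_of_le n l K (by omega) (by omega) lam fun j hj => hpos j (by omega)
      simp only [esymmZ, Nat.cast_add, Nat.cast_one, add_sub_cancel_right, Nat.cast_nonneg,
        if_true, Int.toNat_natCast, sum_esymm_update_zero]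
      linarith
  have hnewton := esymm_newton n K hkn lam
  rw [div_le_div_iff₀ (by positivity) (by positivity)]
  have h := mul_nonneg (neg_nonneg.mpr hterm) (by positivity : (0 : ℝ) ≤ (K : ℝ) + 2)
  push_cast
  linarith
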